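/- Let q ≥ 2 be an integer and β > q. Let X₀ be an arbitrary initial configuration and let 𝒱 = {V₁,…,V_q} be a λ-partition of V with constant λ ∈ (0,1). For any δ ∈ (0,1) there exists a constant C > 0 such that for all sufficiently large n and every integer T ≥ (log n)/(2·log(q/(q−1))) + (log(2/C))/(log(q/(q−1))), with probability at least δ the SW dynamics satisfies max_{k∈[q]} |α₁(X_T) − α_{1,k}(X_T)| ≤ C/√n. -/

import Mathlib

open scoped Classical
open Finset

/-- Spin configurations on `n` vertices with `q` spins. -/
abbrev Conf (n q : ℕ) := Fin n → Fin q

/-- Number of vertices assigned spin `j`. -/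
def cntN {n q : ℕ} (X : Conf n q) (j : Fin q) : ℕ :=
  (Finset.univ.filter (fun v => X v = j)).card

/-- Number of monochromatic pairs `{u,v}` (`u < v`, same spin). -/
def numMono {n q : ℕ} (σ : Conf n q) : ℕ :=
  (Finset.univ.filter (fun p : Fin n × Fin n => p.1 < p.2 ∧ σ p.1 = σ p.2)).card

/-- The mean-field `q`-state Potts measure: probability of `σ`. -/
noncomputable def pottsProb (n q : ℕ) (β : ℝ) (σ : Conf n q) : ℝ :=
  Real.exp (β / n * numMono σ) / ∑ τ : Conf n q, Real.exp (β / n * numMono τ)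

/-- The set of monochromatic pairs of a configuration. -/
def monoPairs {n q : ℕ} (σ : Conf n q) : Finset (Fin n × Fin n) :=
  Finset.univ.filter (fun p : Fin n × Fin n => p.1 < p.2 ∧ σ p.1 = σ p.2)

/-- The graph on `Fin n` whose edges are the pairs in `E`. -/
def graphOf {n : ℕ} (E : Finset (Fin n × Fin n)) : SimpleGraph (Fin n) :=
  SimpleGraph.fromRel (fun u v => (u, v) ∈ E)

/-- Number of connected components of the graph `(V, E)`. -/
noncomputable def numComps {n : ℕ} (E : Finset (Fin n × Fin n)) : ℕ :=
  Nat.card (graphOf E).ConnectedComponent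

/-- One-step transition probability of the Swendsen–Wang dynamics:
percolate on monochromatic pairs with probability `p = 1 - exp (-β/n)`,
then color each connected component uniformly at random. -/
noncomputable def swStep (n q : ℕ) (β : ℝ) (σ τ : Conf n q) : ℝ :=
  ∑ E ∈ (monoPairs σ).powerset,
    ((1 - Real.exp (-(β / n))) ^ E.card *
        Real.exp (-(β / n)) ^ ((monoPairs σ).card - E.card)) *
      (if ∀ u v : Fin n, (graphOf E).Reachable u v → τ u = τ v then
        ((q : ℝ))⁻¹ ^ numComps E else 0)

/-- `t`-step transition probability of the Swendsen–Wang dynamics. -/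
noncomputable def swProb (n q : ℕ) (β : ℝ) : ℕ → Conf n q → Conf n q → ℝ
  | 0, σ, τ => if σ = τ then 1 else 0
  | t + 1, σ, τ => ∑ η : Conf n q, swStep n q β σ η * swProb n q β t η τ

/-- Probability of observing the trajectory `ω 0, ω 1, …, ω (ℓ-1)` at times
`1, …, ℓ` for the SW dynamics started at `X₀`. -/
noncomputable def pathProb (n q : ℕ) (β : ℝ) (X₀ : Conf n q) (ℓ : ℕ)
    (ω : Fin ℓ → Conf n q) : ℝ :=
  ∏ i : Fin ℓ, swStep n q β
    (if _h : 0 < (i : ℕ) then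
        ω ⟨(i : ℕ) - 1, lt_of_le_of_lt (Nat.sub_le _ _) i.isLt⟩
      else X₀) (ω i)

/-- Total variation distance between two probability vectors on configurations. -/
noncomputable def tvDist {n q : ℕ} (f g : Conf n q → ℝ) : ℝ :=
  (∑ τ : Conf n q, |f τ - g τ|) / 2

/-- Mixing time `τ_mix(ε)` of the SW dynamics. -/
noncomputable def mixingTime (n q : ℕ) (β ε : ℝ) : ℕ :=
  sInf {t : ℕ | ∀ σ : Conf n q, tvDist (swProb n q β t σ) (pottsProb n q β) ≤ ε}

/-- `theta lam` is the unique root in `(0,1)` of `exp (-lam * x) = 1 - x`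
for `lam > 1`, and `0` for `lam ≤ 1`. -/
noncomputable def theta (lam : ℝ) : ℝ :=
  if lam ≤ 1 then 0
  else sSup {x : ℝ | x ∈ Set.Ioo (0 : ℝ) 1 ∧ Real.exp (-lam * x) = 1 - x}

/-- The drift function `F`. -/
noncomputable def F (q : ℕ) (β : ℝ) (x : ℝ) : ℝ :=
  1 / q + (1 - 1 / q) * theta (β * x) * x

/-- The unique fixed point of `F` in `(1/q, 1]` (for `β > q`). -/
noncomputable def aFix (q : ℕ) (β : ℝ) : ℝ :=
  sSup {x : ℝ | x ∈ Set.Ioc (1 / (q : ℝ)) 1 ∧ F q β x = x}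

/-- The cutoff constant `c(β,q) = (2 log (1 / F'(a)))⁻¹`. -/
noncomputable def cConst (q : ℕ) (β : ℝ) : ℝ :=
  (2 * Real.log (1 / deriv (F q β) (aFix q β)))⁻¹

/-- Fraction of vertices assigned spin `j`. -/
noncomputable def cntFrac {n q : ℕ} (X : Conf n q) : Fin q → ℝ :=
  fun j => (cntN X j : ℝ) / n

/-- The proportions vector `α(X)`: fractions of vertices of each spin,
sorted in nonincreasing order. -/
noncomputable def alphaVec {n q : ℕ} (X : Conf n q) : Fin q → ℝ :=
  fun i => cntFrac X (Tuple.sort (cntFrac X) i.rev)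

/-- `ℓ∞` distance between two vectors indexed by `Fin q`. -/
noncomputable def linf {q : ℕ} (f g : Fin q → ℝ) : ℝ :=
  ⨆ i : Fin q, |f i - g i|

/-- The vector `κ(b) = (b, (1-b)/(q-1), …, (1-b)/(q-1))`. -/
noncomputable def kappaVec (q : ℕ) (b : ℝ) : Fin q → ℝ :=
  fun i => if (i : ℕ) = 0 then b else (1 - b) / ((q : ℝ) - 1)

/-- The majority vector `m = (a, (1-a)/(q-1), …, (1-a)/(q-1))`. -/
noncomputable def mVec (q : ℕ) (β : ℝ) : Fin q → ℝ :=
  kappaVec q (aFix q β)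

/-- Index of the most common spin of `X` (least such index on ties). -/
noncomputable def domIdx {n q : ℕ} (X : Conf n q) : ℕ :=
  sInf {j : ℕ | ∃ hj : j < q, ∀ j' : Fin q, cntN X j' ≤ cntN X ⟨j, hj⟩}

/-- `α₁(X)`: fraction of vertices carrying the most common spin of `X`. -/
noncomputable def alpha1 {n q : ℕ} (X : Conf n q) : ℝ :=
  ((Finset.univ.filter (fun v : Fin n => (X v : ℕ) = domIdx X)).card : ℝ) / n

/-- `α_{1,k}(X)`: fraction of vertices of `Vk` carrying the most common spin of `X`. -/
noncomputable def alpha1In {n q : ℕ} (X : Conf n q) (Vk : Finset (Fin n)) : ℝ :=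
  ((Vk.filter (fun v => (X v : ℕ) = domIdx X)).card : ℝ) / Vk.card

/-- `P` is a partition of the vertex set into `q` classes. -/
def IsPartition {n q : ℕ} (P : Fin q → Finset (Fin n)) : Prop :=
  (∀ i j, i ≠ j → Disjoint (P i) (P j)) ∧ ∀ v : Fin n, ∃ i, v ∈ P i

/-- A `λ`-partition: a partition with all classes of size at least `λ n`. -/
def IsLamPartition {n q : ℕ} (lam : ℝ) (P : Fin q → Finset (Fin n)) : Prop :=
  IsPartition P ∧ ∀ i, lam * n ≤ ((P i).card : ℝ)

/-- Projection: `projCnt P X i j` is the number of vertices of `P i`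
assigned spin `j` in `X`. -/
def projCnt {n q : ℕ} (P : Fin q → Finset (Fin n)) (X : Conf n q) :
    Fin q → Fin q → ℕ :=
  fun i j => ((P i).filter (fun v => X v = j)).card

/-- All potential edges of the complete graph on `Fin n`. -/
def allPairs (n : ℕ) : Finset (Fin n × Fin n) :=
  Finset.univ.filter (fun p : Fin n × Fin n => p.1 < p.2)

/-- Probability of the edge set `E` under the Erdős–Rényi measure `G(n,p)`. -/
noncomputable def erProb (n : ℕ) (p : ℝ) (E : Finset (Fin n × Fin n)) : ℝ :=
  p ^ E.card * (1 - p) ^ ((allPairs n).card - E.card)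

/-- Size of the connected component of `v` in the graph `(V, E)`. -/
noncomputable def compCard {n : ℕ} (E : Finset (Fin n × Fin n)) (v : Fin n) : ℕ :=
  (Finset.univ.filter (fun u => (graphOf E).Reachable v u)).card

/-- `L₁`: size of the largest connected component. -/
noncomputable def L1 {n : ℕ} (E : Finset (Fin n × Fin n)) : ℕ :=
  Finset.univ.sup (fun v => compCard E v)

/-- Sum of the squares of the component sizes, `Σ_j L_j²`
(computed as `Σ_v |C(v)|`). -/
noncomputable def sumCompSq {n : ℕ} (E : Finset (Fin n × Fin n)) : ℕ :=
  ∑ v : Fin n, compCard E v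

/-- Expectation of `f` under the Erdős–Rényi measure `G(n,p)`. -/
noncomputable def erExp (n : ℕ) (p : ℝ) (f : Finset (Fin n × Fin n) → ℝ) : ℝ :=
  ∑ E ∈ (allPairs n).powerset, erProb n p E * f E

/-- Random-cluster weight of an edge set with parameters `q`, `p = 1 - exp (-β/n)`. -/
noncomputable def rcWeight (n q : ℕ) (β : ℝ) (E : Finset (Fin n × Fin n)) : ℝ :=
  (1 - Real.exp (-(β / n))) ^ E.card *
    Real.exp (-(β / n)) ^ ((allPairs n).card - E.card) * (q : ℝ) ^ numComps E

/-- The mean-field random-cluster measure: probability of the edge set `E`. -/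
noncomputable def rcProb (n q : ℕ) (β : ℝ) (E : Finset (Fin n × Fin n)) : ℝ :=
  rcWeight n q β E / ∑ B ∈ (allPairs n).powerset, rcWeight n q β B

/-- Percolation weight of the edge set `E` inside `M`. -/
noncomputable def edgeWeight (n : ℕ) (β : ℝ) (M E : Finset (Fin n × Fin n)) : ℝ :=
  (1 - Real.exp (-(β / n))) ^ E.card * Real.exp (-(β / n)) ^ (M.card - E.card)

/-- Probability of the coloring `τ` when every component of `(V, E)` receives a uniform spin. -/
noncomputable def colorWeight {n : ℕ} (q : ℕ) (E : Finset (Fin n × Fin n)) (τ : Conf n q) : ℝ :=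
  if ∀ u v : Fin n, (graphOf E).Reachable u v → τ u = τ v then
    ((q : ℝ))⁻¹ ^ numComps E else 0

lemma swStep_eq (n q : ℕ) (β : ℝ) (σ τ : Conf n q) :
    swStep n q β σ τ =
      ∑ E ∈ (monoPairs σ).powerset, edgeWeight n β (monoPairs σ) E * colorWeight q E τ := rfl

lemma colorWeight_nonneg {n : ℕ} (q : ℕ) (E : Finset (Fin n × Fin n)) (τ : Conf n q) :
    0 ≤ colorWeight q E τ := by
  unfold colorWeight
  split_ifs <;> positivity

lemma edgeWeight_nonneg {n : ℕ} {β : ℝ} (hβ : 0 ≤ β) (M E : Finset (Fin n × Fin n)) :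
    0 ≤ edgeWeight n β M E := by
  have h : Real.exp (-(β / n)) ≤ 1 := Real.exp_le_one_iff.2 (by
    have : 0 ≤ β / n := by positivity
    linarith)
  have h' : 0 ≤ 1 - Real.exp (-(β / n)) := by linarith
  unfold edgeWeight
  positivity

lemma swStep_nonneg {n q : ℕ} {β : ℝ} (hβ : 0 ≤ β) (σ τ : Conf n q) :
    0 ≤ swStep n q β σ τ := by
  rw [swStep_eq]
  exact Finset.sum_nonneg fun E _ =>
    mul_nonneg (edgeWeight_nonneg hβ _ _) (colorWeight_nonneg _ _ _)

lemma sum_edgeWeight_disjoint {n : ℕ} (β : ℝ) {M N : Finset (Fin n × Fin n)} (h : N ⊆ M) :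
    ∑ E ∈ M.powerset, edgeWeight n β M E * (if Disjoint E N then 1 else 0) =
      Real.exp (-(β / n)) ^ N.card := by
  have hf : M.powerset.filter (fun E => Disjoint E N) = (M \ N).powerset := by
    ext E
    simp [Finset.subset_sdiff]
  simp only [mul_ite, mul_one, mul_zero]
  rw [← Finset.sum_filter, hf]
  have hM : M.card = (M \ N).card + N.card := (Finset.card_sdiff_add_card_eq_card h).symm
  have hE : ∀ E ∈ (M \ N).powerset, edgeWeight n β M E =
      ((1 - Real.exp (-(β / n))) ^ E.card * Real.exp (-(β / n)) ^ ((M \ N).card - E.card)) *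
        Real.exp (-(β / n)) ^ N.card := by
    intro E hE
    have hc := Finset.card_le_card (Finset.mem_powerset.1 hE)
    rw [edgeWeight, mul_assoc, ← pow_add]
    congr 2
    omega
  rw [Finset.sum_congr rfl hE, ← Finset.sum_mul, Finset.sum_pow_mul_eq_add_pow]
  simp

lemma sum_edgeWeight {n : ℕ} (β : ℝ) (M : Finset (Fin n × Fin n)) :
    ∑ E ∈ M.powerset, edgeWeight n β M E = 1 := by
  simpa using sum_edgeWeight_disjoint β (Finset.empty_subset M)

lemma sum_colorWeight_mul {n : ℕ} (q : ℕ) (E : Finset (Fin n × Fin n)) (g : Conf n q → ℝ) :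
    ∑ τ : Conf n q, colorWeight q E τ * g τ =
      (q : ℝ)⁻¹ ^ numComps E * ∑ c : (graphOf E).ConnectedComponent → Fin q,
        g (fun v => c ((graphOf E).connectedComponentMk v)) := by
  simp only [colorWeight, ite_mul, zero_mul]
  rw [← Finset.sum_filter, ← Finset.mul_sum]
  congr 1
  refine (Finset.sum_bij
    (fun (c : (graphOf E).ConnectedComponent → Fin q) _ =>
      fun v => c ((graphOf E).connectedComponentMk v)) ?_ ?_ ?_ ?_).symm
  · intro c _
    simp only [Finset.mem_filter, Finset.mem_univ, true_and]
    intro u v huv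
    rw [SimpleGraph.ConnectedComponent.sound huv]
  · intro c _ c' _ h
    funext C
    induction C using SimpleGraph.ConnectedComponent.ind with
    | _ v => exact congrFun h v
  · intro τ hτ
    simp only [Finset.mem_filter, Finset.mem_univ, true_and] at hτ
    refine ⟨fun C => C.lift τ (fun u v p _ => hτ u v p.reachable), Finset.mem_univ _, ?_⟩
    funext v
    simp
  · intro c _
    rfl

lemma sum_pi_apply {ι : Type*} [Fintype ι] {κ : Type*} [Fintype κ] (a : ι) (G : κ → ℝ) :
    ∑ c : ι → κ, G (c a) = (Fintype.card κ : ℝ) ^ (Fintype.card ι - 1) * ∑ x, G x := by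
  rw [← (Equiv.funSplitAt a κ).symm.sum_comp, Fintype.sum_prod_type, Finset.mul_sum]
  refine Finset.sum_congr rfl fun x _ => ?_
  simp [Equiv.funSplitAt, Equiv.piSplitAt, Fintype.card_subtype_compl]

lemma sum_pi_apply_mul_apply {ι : Type*} [Fintype ι] {κ : Type*} [Fintype κ] {a b : ι}
    (hab : a ≠ b) (G H : κ → ℝ) (hG : ∑ x, G x = 0) :
    ∑ c : ι → κ, G (c a) * H (c b) = 0 := by
  rw [← (Equiv.funSplitAt a κ).symm.sum_comp, Fintype.sum_prod_type_right]
  refine Finset.sum_eq_zero fun c _ => ?_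
  simp [Equiv.funSplitAt, Equiv.piSplitAt, hab.symm, ← Finset.sum_mul, hG]

lemma sum_colorWeight {n q : ℕ} (hq : 2 ≤ q) (E : Finset (Fin n × Fin n)) :
    ∑ τ : Conf n q, colorWeight q E τ = 1 := by
  have h := sum_colorWeight_mul q E (fun _ => 1)
  have hq' : (q : ℝ) ≠ 0 := by positivity
  simp only [mul_one] at h
  rw [h]
  simp [numComps, Nat.card_eq_fintype_card, hq']

/-- The centered indicator of the spin `j`. -/
noncomputable def centInd {q : ℕ} (j x : Fin q) : ℝ := (if x = j then 1 else 0) - (q : ℝ)⁻¹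

lemma sum_centInd {q : ℕ} (hq : 2 ≤ q) (j : Fin q) : ∑ x, centInd j x = 0 := by
  have hq' : (q : ℝ) ≠ 0 := by positivity
  simp [centInd, hq']

lemma sum_centInd_sq {q : ℕ} (hq : 2 ≤ q) (j : Fin q) :
    ∑ x, centInd j x * centInd j x = 1 - (q : ℝ)⁻¹ := by
  have hq' : (q : ℝ) ≠ 0 := by positivity
  have h : ∀ x : Fin q, centInd j x * centInd j x =
      (if x = j then 1 else 0) * (1 - (q : ℝ)⁻¹) - (q : ℝ)⁻¹ * centInd j x := by
    intro x
    unfold centInd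
    split_ifs <;> ring
  simp only [h, Finset.sum_sub_distrib, ← Finset.sum_mul, ← Finset.mul_sum, sum_centInd hq]
  simp

lemma sum_colorWeight_centInd_mul {n q : ℕ} (hq : 2 ≤ q) (E : Finset (Fin n × Fin n))
    (j : Fin q) (u v : Fin n) :
    ∑ τ : Conf n q, colorWeight q E τ * (centInd j (τ u) * centInd j (τ v)) =
      if (graphOf E).Reachable u v then (q : ℝ)⁻¹ * (1 - (q : ℝ)⁻¹) else 0 := by
  have hq' : (q : ℝ) ≠ 0 := by positivity
  rw [sum_colorWeight_mul q E (fun τ => centInd j (τ u) * centInd j (τ v))]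
  beta_reduce
  split_ifs with h
  · rw [SimpleGraph.ConnectedComponent.sound h]
    rw [sum_pi_apply ((graphOf E).connectedComponentMk v) (fun x => centInd j x * centInd j x),
      sum_centInd_sq hq, ← mul_assoc]
    congr 1
    have : 0 < Fintype.card (graphOf E).ConnectedComponent :=
      Fintype.card_pos_iff.2 ⟨(graphOf E).connectedComponentMk v⟩
    rw [numComps, Nat.card_eq_fintype_card]
    obtain ⟨k, hk⟩ := Nat.exists_eq_succ_of_ne_zero this.ne'
    rw [hk, Fintype.card_fin, Nat.succ_sub_one, pow_succ, mul_right_comm, ← mul_pow,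
      inv_mul_cancel₀ hq', one_pow, one_mul]
  · rw [sum_pi_apply_mul_apply (fun h' => h (SimpleGraph.ConnectedComponent.exact h')) _ _
      (sum_centInd hq j), mul_zero]

/-- Second moment of a centered linear statistic of a random coloring of the components. -/
lemma sum_colorWeight_sq {n q : ℕ} (hq : 2 ≤ q) (E : Finset (Fin n × Fin n)) (φ : Fin n → ℝ) :
    ∑ τ : Conf n q, colorWeight q E τ * ∑ j, (∑ u, φ u * centInd j (τ u)) ^ 2 =
      (1 - (q : ℝ)⁻¹) *
        ∑ u, ∑ v, φ u * φ v * (if (graphOf E).Reachable u v then 1 else 0) := by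
  have hq' : (q : ℝ) ≠ 0 := by positivity
  have h1 : ∀ j : Fin q, ∑ τ : Conf n q,
      colorWeight q E τ * (∑ u, φ u * centInd j (τ u)) ^ 2 =
      ∑ u, ∑ v, φ u * φ v * (if (graphOf E).Reachable u v then
        (q : ℝ)⁻¹ * (1 - (q : ℝ)⁻¹) else 0) := by
    intro j
    have hsq : ∀ τ : Conf n q, (∑ u, φ u * centInd j (τ u)) ^ 2 =
        ∑ u, ∑ v, (φ u * centInd j (τ u)) * (φ v * centInd j (τ v)) := fun τ => by
      rw [pow_two, Finset.sum_mul_sum]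
    simp only [← sum_colorWeight_centInd_mul hq E j, hsq, Finset.mul_sum]
    rw [Finset.sum_comm]
    refine Finset.sum_congr rfl fun u _ => ?_
    rw [Finset.sum_comm]
    refine Finset.sum_congr rfl fun v _ => Finset.sum_congr rfl fun τ _ => by ring
  simp only [Finset.mul_sum (s := (Finset.univ : Finset (Fin q)))]
  rw [Finset.sum_comm]
  simp only [h1, Finset.sum_const, Finset.card_univ, Fintype.card_fin, nsmul_eq_mul,
    Finset.mul_sum]
  refine Finset.sum_congr rfl fun u _ => Finset.sum_congr rfl fun v _ => ?_
  split_ifs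
  · field_simp
  · simp

/-- Two vertices receive equal spins with probability at least `1/q`. -/
lemma sum_colorWeight_ne_le {n q : ℕ} (hq : 2 ≤ q) (E : Finset (Fin n × Fin n)) (u v : Fin n) :
    ∑ τ : Conf n q, colorWeight q E τ * (if τ u = τ v then 0 else 1) ≤ 1 - (q : ℝ)⁻¹ := by
  have hq' : (q : ℝ) ≠ 0 := by positivity
  have hq1 : (q : ℝ)⁻¹ ≤ 1 := inv_le_one_of_one_le₀ (by exact_mod_cast (by omega : 1 ≤ q))
  have h1 : ∀ τ : Conf n q, (if τ u = τ v then (0 : ℝ) else 1) =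
      (1 - (q : ℝ)⁻¹) - ∑ j, centInd j (τ u) * centInd j (τ v) := by
    intro τ
    have : ∀ j, centInd j (τ u) * centInd j (τ v) =
        (if j = τ u then (if τ u = τ v then 1 else 0) else 0)
          - (q : ℝ)⁻¹ * (if j = τ u then 1 else 0)
          - (q : ℝ)⁻¹ * (if j = τ v then 1 else 0) + (q : ℝ)⁻¹ * (q : ℝ)⁻¹ := by
      intro j
      unfold centInd
      by_cases ha : τ u = j
      · subst ha
        by_cases hb : τ v = τ u
        · simp [hb]; ring
        · simp [hb, Ne.symm hb]; ring
      · by_cases hb : τ v = j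
        · subst hb
          simp [ha, Ne.symm ha]; ring
        · simp [ha, hb, Ne.symm ha, Ne.symm hb]
    simp only [this, Finset.sum_add_distrib, Finset.sum_sub_distrib, ← Finset.mul_sum,
      Finset.sum_ite_eq', Finset.mem_univ, if_true, Finset.sum_const, Finset.card_univ,
      Fintype.card_fin, nsmul_eq_mul]
    split_ifs <;> field_simp <;> ring
  simp only [h1, mul_sub, Finset.sum_sub_distrib, ← Finset.sum_mul, sum_colorWeight hq, one_mul,
    Finset.mul_sum]
  rw [Finset.sum_comm]
  simp only [sum_colorWeight_centInd_mul hq]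
  have : 0 ≤ ∑ _j : Fin q, if (graphOf E).Reachable u v then
      (q : ℝ)⁻¹ * (1 - (q : ℝ)⁻¹) else 0 := by
    refine Finset.sum_nonneg fun _ _ => ?_
    have := sub_nonneg.2 hq1
    split_ifs <;> positivity
  linarith

/-- The pair `p` with the vertices `a` and `b` exchanged, listed in increasing order. -/
def swapPair {n : ℕ} (a b : Fin n) (p : Fin n × Fin n) : Fin n × Fin n :=
  if Equiv.swap a b p.1 < Equiv.swap a b p.2 then (Equiv.swap a b p.1, Equiv.swap a b p.2)
  else (Equiv.swap a b p.2, Equiv.swap a b p.1)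

lemma apply_swap_of_eq {n q : ℕ} {σ : Conf n q} {a b : Fin n} (h : σ a = σ b) (x : Fin n) :
    σ (Equiv.swap a b x) = σ x := by
  by_cases hxa : x = a
  · subst hxa; simp [h]
  · by_cases hxb : x = b
    · subst hxb; simp [h]
    · rw [Equiv.swap_apply_of_ne_of_ne hxa hxb]

lemma swapPair_mem_monoPairs {n q : ℕ} {σ : Conf n q} {a b : Fin n} (h : σ a = σ b)
    {p : Fin n × Fin n} (hp : p ∈ monoPairs σ) : swapPair a b p ∈ monoPairs σ := by
  simp only [monoPairs, Finset.mem_filter, Finset.mem_univ, true_and] at hp ⊢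
  have hne : Equiv.swap a b p.1 ≠ Equiv.swap a b p.2 :=
    fun h' => hp.1.ne ((Equiv.swap a b).injective h')
  unfold swapPair
  split_ifs with hlt
  · exact ⟨hlt, by simp only [apply_swap_of_eq h, hp.2]⟩
  · exact ⟨lt_of_le_of_ne (not_lt.1 hlt) hne.symm, by simp only [apply_swap_of_eq h, hp.2]⟩

lemma swapPair_swapPair {n : ℕ} (a b : Fin n) {p : Fin n × Fin n} (hp : p.1 < p.2) :
    swapPair a b (swapPair a b p) = p := by
  unfold swapPair
  split_ifs with h1 h2 h2
  · simp
  · simp [hp] at h2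
  · simp [hp.not_gt] at h2
  · simp

lemma image_swapPair_image {n : ℕ} (a b : Fin n) {E : Finset (Fin n × Fin n)}
    (hE : ∀ p ∈ E, p.1 < p.2) : (E.image (swapPair a b)).image (swapPair a b) = E := by
  rw [Finset.image_image]
  conv_rhs => rw [← Finset.image_id (s := E)]
  exact Finset.image_congr fun p hp => swapPair_swapPair a b (hE p hp)

lemma reachable_image_swapPair {n : ℕ} (a b : Fin n) {E : Finset (Fin n × Fin n)} {u v : Fin n}
    (h : (graphOf E).Reachable u v) :
    (graphOf (E.image (swapPair a b))).Reachable (Equiv.swap a b u) (Equiv.swap a b v) := by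
  have key : ∀ x y, (x, y) ∈ E →
      (Equiv.swap a b x, Equiv.swap a b y) ∈ E.image (swapPair a b) ∨
        (Equiv.swap a b y, Equiv.swap a b x) ∈ E.image (swapPair a b) := by
    intro x y hxy
    have := Finset.mem_image_of_mem (swapPair a b) hxy
    unfold swapPair at this ⊢
    dsimp only at this
    split_ifs at this
    · exact Or.inl this
    · exact Or.inr this
  let φ : graphOf E →g graphOf (E.image (swapPair a b)) :=
    { toFun := Equiv.swap a b
      map_rel' := by
        intro x y hxy
        obtain ⟨hne, hmem⟩ := (SimpleGraph.fromRel_adj _ _ _).1 hxy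
        refine (SimpleGraph.fromRel_adj _ _ _).2
          ⟨fun h' => hne ((Equiv.swap a b).injective h'), ?_⟩
        rcases hmem with hmem | hmem
        · exact key x y hmem
        · exact (key y x hmem).symm }
  exact h.map φ

/-- Probability that `u` and `v` are connected after percolation on the pairs of `M`. -/
noncomputable def connProb (n : ℕ) (β : ℝ) (M : Finset (Fin n × Fin n)) (u v : Fin n) : ℝ :=
  ∑ E ∈ M.powerset, edgeWeight n β M E * (if (graphOf E).Reachable u v then 1 else 0)

lemma connProb_nonneg {n : ℕ} {β : ℝ} (hβ : 0 ≤ β) (M : Finset (Fin n × Fin n)) (u v : Fin n) :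
    0 ≤ connProb n β M u v :=
  Finset.sum_nonneg fun E _ => mul_nonneg (edgeWeight_nonneg hβ _ _) (by split_ifs <;> simp)

lemma connProb_self (n : ℕ) (β : ℝ) (M : Finset (Fin n × Fin n)) (u : Fin n) :
    connProb n β M u u = 1 := by
  simp [connProb, sum_edgeWeight]

lemma connProb_eq_zero {n q : ℕ} (β : ℝ) {σ : Conf n q} {u v : Fin n} (h : σ u ≠ σ v) :
    connProb n β (monoPairs σ) u v = 0 := by
  refine Finset.sum_eq_zero fun E hE => ?_
  rw [if_neg, mul_zero]
  rintro ⟨p⟩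
  refine h ?_
  clear h
  induction p with
  | nil => rfl
  | cons hadj _ ih =>
    rw [← ih]
    have hmem : ∀ {x y}, (x, y) ∈ E → σ x = σ y := fun hxy => by
      have := Finset.mem_powerset.1 hE hxy
      simp only [monoPairs, Finset.mem_filter] at this
      exact this.2.2
    rcases (SimpleGraph.fromRel_adj _ _ _).1 hadj with ⟨_, h | h⟩
    · exact hmem h
    · exact (hmem h).symm

/-- Connection probabilities are invariant under exchanging two vertices of equal spin. -/
lemma connProb_swap {n q : ℕ} (β : ℝ) {σ : Conf n q} {a b : Fin n} (h : σ a = σ b)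
    (u v : Fin n) :
    connProb n β (monoPairs σ) u v =
      connProb n β (monoPairs σ) (Equiv.swap a b u) (Equiv.swap a b v) := by
  have hlt : ∀ E ∈ (monoPairs σ).powerset, ∀ p ∈ E, p.1 < p.2 := fun E hE p hp => by
    have := Finset.mem_powerset.1 hE hp
    simp only [monoPairs, Finset.mem_filter] at this
    exact this.2.1
  have hmem : ∀ E ∈ (monoPairs σ).powerset, E.image (swapPair a b) ∈ (monoPairs σ).powerset := by
    intro E hE
    rw [Finset.mem_powerset] at hE ⊢
    exact Finset.image_subset_iff.2 fun p hp => swapPair_mem_monoPairs h (hE hp)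
  have hcard : ∀ E ∈ (monoPairs σ).powerset, (E.image (swapPair a b)).card = E.card := by
    intro E hE
    refine Finset.card_image_of_injOn fun p hp p' hp' hpp => ?_
    rw [← swapPair_swapPair a b (hlt E hE p hp), hpp, swapPair_swapPair a b (hlt E hE p' hp')]
  refine Finset.sum_nbij' (fun E => E.image (swapPair a b)) (fun E => E.image (swapPair a b))
    hmem hmem (fun E hE => image_swapPair_image a b (hlt E hE))
    (fun E hE => image_swapPair_image a b (hlt E hE)) fun E hE => ?_
  have hiff : (graphOf E).Reachable u v ↔ (graphOf (E.image (swapPair a b))).Reachable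
      (Equiv.swap a b u) (Equiv.swap a b v) := by
    refine ⟨reachable_image_swapPair a b, fun h' => ?_⟩
    simpa [image_swapPair_image a b (hlt E hE)] using reachable_image_swapPair a b h'
  simp only [edgeWeight, hcard E hE, hiff]

/-- The connection quadratic form is bounded by the squared norm on vectors with zero sum over
each spin class. -/
lemma sum_connProb_le {n q : ℕ} {β : ℝ} (hβ : 0 ≤ β) (σ : Conf n q) (h : Fin n → ℝ)
    (h0 : ∀ j, ∑ u, (if σ u = j then h u else 0) = 0) :
    ∑ u, ∑ v, h u * h v * connProb n β (monoPairs σ) u v ≤ ∑ u, h u ^ 2 := by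
  refine Finset.sum_le_sum fun u _ => ?_
  obtain ⟨c, hc0, hc⟩ : ∃ c : ℝ, 0 ≤ c ∧
      ∀ v, v ≠ u → σ v = σ u → connProb n β (monoPairs σ) u v = c := by
    by_cases hex : ∃ v, v ≠ u ∧ σ v = σ u
    · obtain ⟨w, hwu, hw⟩ := hex
      refine ⟨_, connProb_nonneg hβ (monoPairs σ) u w, fun v hvu hv => ?_⟩
      rw [connProb_swap β (hv.trans hw.symm), Equiv.swap_apply_left,
        Equiv.swap_apply_of_ne_of_ne hvu.symm hwu.symm]
    · exact ⟨0, le_rfl, fun v hvu hv => absurd ⟨v, hvu, hv⟩ hex⟩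
  have hv : ∀ v, h u * h v * connProb n β (monoPairs σ) u v =
      h u * c * (if σ v = σ u then h v else 0) +
        (if v = u then h u * h u * (1 - c) else 0) := by
    intro v
    by_cases hvu : v = u
    · subst hvu
      simp [connProb_self]; ring
    · by_cases hs : σ v = σ u
      · simp [hvu, hs, hc v hvu hs]; ring
      · simp [hvu, hs, connProb_eq_zero β (Ne.symm hs)]
  simp only [hv, Finset.sum_add_distrib, ← Finset.mul_sum, h0]
  simp only [mul_zero, Finset.sum_ite_eq', Finset.mem_univ, if_true, zero_add]
  nlinarith [mul_nonneg hc0 (mul_self_nonneg (h u))]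

/-- Pairs having `u` as an endpoint. -/
def incidentPairs {n : ℕ} (u : Fin n) : Finset (Fin n × Fin n) :=
  Finset.univ.filter fun p => p.1 = u ∨ p.2 = u

/-- `u` is isolated in the graph `(V, E)`. -/
def IsIsolatedIn {n : ℕ} (E : Finset (Fin n × Fin n)) (u : Fin n) : Prop :=
  Disjoint E (incidentPairs u)

lemma IsIsolatedIn.eq_of_reachable {n : ℕ} {E : Finset (Fin n × Fin n)} {u v : Fin n}
    (hu : IsIsolatedIn E u) (h : (graphOf E).Reachable u v) : v = u := by
  obtain ⟨p⟩ := h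
  cases p with
  | nil => rfl
  | cons hadj _ =>
    exfalso
    rcases (SimpleGraph.fromRel_adj _ _ _).1 hadj with ⟨_, h | h⟩
    · exact Finset.disjoint_left.1 hu h (by simp [incidentPairs])
    · exact Finset.disjoint_left.1 hu h (by simp [incidentPairs])

lemma card_monoPairs_inter_incidentPairs_le {n q : ℕ} (σ : Conf n q) (u : Fin n) :
    (monoPairs σ ∩ incidentPairs u).card ≤ n := by
  have hsub : monoPairs σ ∩ incidentPairs u ⊆
      Finset.univ.image (fun v => if u < v then (u, v) else (v, u)) := by
    rintro ⟨x, y⟩ hp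
    simp only [monoPairs, incidentPairs, Finset.mem_inter, Finset.mem_filter, Finset.mem_univ,
      true_and] at hp
    obtain ⟨⟨hlt, _⟩, rfl | rfl⟩ := hp
    · exact Finset.mem_image.2 ⟨y, Finset.mem_univ _, by simp [hlt]⟩
    · exact Finset.mem_image.2 ⟨x, Finset.mem_univ _, by simp [hlt.not_gt]⟩
  simpa using (Finset.card_le_card hsub).trans Finset.card_image_le

/-- Two given vertices are both isolated with probability bounded away from `0`. -/
lemma exp_le_sum_edgeWeight_isolated {n q : ℕ} {β : ℝ} (hβ : 0 ≤ β) (σ : Conf n q)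
    (u v : Fin n) :
    ∑ E ∈ (monoPairs σ).powerset, edgeWeight n β (monoPairs σ) E *
      (if IsIsolatedIn E u ∧ IsIsolatedIn E v then 0 else 1) ≤ 1 - Real.exp (-(2 * β)) := by
  set N := monoPairs σ ∩ incidentPairs u ∪ monoPairs σ ∩ incidentPairs v with hN
  have hNM : N ⊆ monoPairs σ :=
    Finset.union_subset Finset.inter_subset_left Finset.inter_subset_left
  have hcard : N.card ≤ 2 * n := by
    have h := Finset.card_union_le (monoPairs σ ∩ incidentPairs u) (monoPairs σ ∩ incidentPairs v)
    rw [← hN] at h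
    have := card_monoPairs_inter_incidentPairs_le σ u
    have := card_monoPairs_inter_incidentPairs_le σ v
    omega
  have hterm : ∀ E ∈ (monoPairs σ).powerset, edgeWeight n β (monoPairs σ) E *
      (if IsIsolatedIn E u ∧ IsIsolatedIn E v then 0 else 1) =
      edgeWeight n β (monoPairs σ) E -
        edgeWeight n β (monoPairs σ) E * (if Disjoint E N then 1 else 0) := by
    intro E hE
    have hEM := Finset.mem_powerset.1 hE
    have hd : ∀ w, Disjoint E (monoPairs σ ∩ incidentPairs w) ↔ IsIsolatedIn E w := by
      intro w
      rw [IsIsolatedIn, Finset.disjoint_left, Finset.disjoint_left]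
      exact forall₂_congr fun p hp => by simp [hEM hp]
    have hdN : Disjoint E N ↔ IsIsolatedIn E u ∧ IsIsolatedIn E v := by
      rw [hN, Finset.disjoint_union_right, hd, hd]
    simp only [hdN]
    split_ifs <;> ring
  rw [Finset.sum_congr rfl hterm, Finset.sum_sub_distrib, sum_edgeWeight,
    sum_edgeWeight_disjoint β hNM]
  have hle : Real.exp (-(2 * β)) ≤ Real.exp (-(β / n)) ^ N.card := by
    rw [← Real.exp_nat_mul]
    refine Real.exp_le_exp.2 ?_
    rcases Nat.eq_zero_or_pos n with rfl | hn
    · simp; linarith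
    · have h1 : (N.card : ℝ) ≤ 2 * n := by exact_mod_cast hcard
      have h2 : (0 : ℝ) < n := by exact_mod_cast hn
      have h3 : 0 ≤ β / n := by positivity
      have h4 : 2 * (n : ℝ) * (β / n) = 2 * β := by field_simp
      nlinarith [mul_le_mul_of_nonneg_right h1 h3]
  linarith

/-- A vector with zero sum is transported by nonnegative weights from its positive to its
negative part. -/
lemma exists_transport {ι : Type*} [Fintype ι] (g : ι → ℝ) (hg : ∑ u, g u = 0) :
    ∃ w : ι → ι → ℝ, (∀ u v, 0 ≤ w u v) ∧ 2 * ∑ u, ∑ v, w u v = ∑ u, |g u| ∧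
      ∀ y : ι → ℝ, ∑ u, g u * y u = ∑ u, ∑ v, w u v * (y u - y v) := by
  set S := ∑ u, (g u)⁺ with hS
  have hpm : ∀ u, g u = (g u)⁺ - (g u)⁻ := fun u => (posPart_sub_negPart (g u)).symm
  have habs : ∀ u, |g u| = (g u)⁺ + (g u)⁻ := fun u => (posPart_add_negPart (g u)).symm
  have hS' : ∑ u, (g u)⁻ = S := by
    have : ∑ u, g u = ∑ u, (g u)⁺ - ∑ u, (g u)⁻ := by
      rw [← Finset.sum_sub_distrib]
      exact Finset.sum_congr rfl fun u _ => hpm u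
    linarith
  have hA : ∑ u, |g u| = 2 * S := by
    simp only [habs, Finset.sum_add_distrib, hS', ← hS]
    ring
  have hS0 : 0 ≤ S := Finset.sum_nonneg fun u _ => posPart_nonneg _
  rcases hS0.eq_or_lt with h0 | hpos
  · refine ⟨fun _ _ => 0, fun _ _ => le_rfl, by simp [hA, ← h0], fun y => ?_⟩
    have hz : ∀ u, g u = 0 := fun u => by
      have := (Finset.sum_eq_zero_iff_of_nonneg (fun u _ => abs_nonneg (g u))).1
        (hA.trans (by rw [← h0, mul_zero])) u (Finset.mem_univ u)
      exact abs_eq_zero.1 this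
    simp [hz]
  · refine ⟨fun u v => (g u)⁺ * (g v)⁻ / S, fun u v => by positivity, ?_, fun y => ?_⟩
    · rw [hA]
      simp only [← Finset.sum_div, ← Finset.mul_sum, ← Finset.sum_mul, hS', ← hS]
      field_simp
    · have h1 : ∀ u v, (g u)⁺ * (g v)⁻ / S * (y u - y v) =
          ((g u)⁺ * y u) * (g v)⁻ / S - (g u)⁺ * ((g v)⁻ * y v) / S := fun u v => by ring
      simp only [h1, Finset.sum_sub_distrib, ← Finset.sum_div, ← Finset.mul_sum,
        ← Finset.sum_mul, hS', ← hS]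
      rw [mul_div_assoc, div_self hpos.ne', mul_one, mul_comm S, mul_div_assoc,
        div_self hpos.ne', mul_one, ← Finset.sum_sub_distrib]
      exact Finset.sum_congr rfl fun u _ => by rw [← sub_mul, ← hpm]

/-- Sum of `f` over the vertices of spin `j`. -/
noncomputable def spinSum {n q : ℕ} (f : Fin n → ℝ) (X : Conf n q) (j : Fin q) : ℝ :=
  ∑ u, if X u = j then f u else 0

/-- Average of `f` over the spin class of each vertex. -/
noncomputable def classMean {n q : ℕ} (f : Fin n → ℝ) (σ : Conf n q) (u : Fin n) : ℝ :=
  spinSum f σ (σ u) / cntN σ (σ u)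

lemma sum_spinSum {n q : ℕ} (f : Fin n → ℝ) (X : Conf n q) : ∑ j, spinSum f X j = ∑ u, f u := by
  simp only [spinSum]
  rw [Finset.sum_comm]
  simp

lemma cntN_pos {n q : ℕ} (σ : Conf n q) (u : Fin n) : 0 < cntN σ (σ u) :=
  Finset.card_pos.2 ⟨u, by simp⟩

lemma sum_comp_classMean {n q : ℕ} (f : Fin n → ℝ) (σ : Conf n q) {φ : ℝ → ℝ} (hφ : φ 0 = 0)
    (hφm : ∀ x (k : ℕ), φ (x / k) = φ x / k) (j : Fin q) :
    ∑ u, (if σ u = j then φ (classMean f σ u) else 0) = φ (spinSum f σ j) := by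
  have h : ∀ u, (if σ u = j then φ (classMean f σ u) else 0) =
      (if σ u = j then φ (spinSum f σ j) / cntN σ j else 0) := by
    intro u
    split_ifs with hu
    · rw [classMean, hu, hφm]
    · rfl
  simp only [h]
  rw [← Finset.sum_filter, Finset.sum_const, nsmul_eq_mul]
  change (cntN σ j : ℝ) * _ = _
  by_cases hc : cntN σ j = 0
  · have : spinSum f σ j = 0 := by
      refine Finset.sum_eq_zero fun u _ => if_neg fun hu => ?_
      have := cntN_pos σ u
      rw [hu] at this
      omega
    simp [this, hφ]
  · field_simp

lemma spinSum_classMean {n q : ℕ} (f : Fin n → ℝ) (σ : Conf n q) (j : Fin q) :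
    spinSum (classMean f σ) σ j = spinSum f σ j :=
  sum_comp_classMean f σ (φ := id) rfl (fun _ _ => rfl) j

lemma sum_classMean {n q : ℕ} (f : Fin n → ℝ) (σ : Conf n q) :
    ∑ u, classMean f σ u = ∑ u, f u := by
  rw [← sum_spinSum _ σ, ← sum_spinSum f σ]
  exact Finset.sum_congr rfl fun j _ => spinSum_classMean f σ j

lemma sum_abs_classMean {n q : ℕ} (f : Fin n → ℝ) (σ : Conf n q) :
    ∑ u, |classMean f σ u| = ∑ j, |spinSum f σ j| := by
  rw [← sum_spinSum (fun u => |classMean f σ u|) σ]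
  exact Finset.sum_congr rfl fun j _ => sum_comp_classMean f σ (φ := abs) abs_zero
    (fun x k => by rw [abs_div, Nat.abs_cast]) j

lemma abs_classMean_le {n q : ℕ} {f : Fin n → ℝ} {B : ℝ} (hB : ∀ u, |f u| ≤ B) (σ : Conf n q)
    (u : Fin n) : |classMean f σ u| ≤ B := by
  have hc : (0 : ℝ) < cntN σ (σ u) := by exact_mod_cast cntN_pos σ u
  rw [classMean, abs_div, Nat.abs_cast, div_le_iff₀ hc, spinSum, ← Finset.sum_filter, mul_comm,
    cntN, ← nsmul_eq_mul]
  exact (Finset.abs_sum_le_sum_abs _ _).trans (Finset.sum_le_card_nsmul _ _ _ fun v _ => hB v)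

lemma sum_abs_centInd {q : ℕ} (hq : 2 ≤ q) (x : Fin q) :
    ∑ j, |centInd j x| = 2 * (1 - (q : ℝ)⁻¹) := by
  have hq' : (q : ℝ) ≠ 0 := by positivity
  have hq1 : (q : ℝ)⁻¹ ≤ 1 := inv_le_one_of_one_le₀ (by exact_mod_cast (by omega : 1 ≤ q))
  have h : ∀ j, |centInd j x| = (if j = x then 1 - 2 * (q : ℝ)⁻¹ else 0) + (q : ℝ)⁻¹ := by
    intro j
    unfold centInd
    by_cases hj : x = j
    · subst hj
      simp [abs_of_nonneg (sub_nonneg.2 hq1)]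
      ring
    · simp [hj, Ne.symm hj]
  simp only [h, Finset.sum_add_distrib, Finset.sum_ite_eq', Finset.mem_univ, if_true,
    Finset.sum_const, Finset.card_univ, Fintype.card_fin, nsmul_eq_mul]
  field_simp
  ring

lemma sum_abs_indicator_sub {q : ℕ} (x y : Fin q) :
    ∑ j, |(if x = j then (1 : ℝ) else 0) - (if y = j then 1 else 0)| =
      2 * (if x = y then 0 else 1) := by
  by_cases h : x = y
  · simp [h]
  · have hj : ∀ j, |(if x = j then (1 : ℝ) else 0) - (if y = j then 1 else 0)| =
        (if x = j then 1 else 0) + (if y = j then 1 else 0) := by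
      intro j
      by_cases hx : x = j
      · subst hx
        simp [Ne.symm h]
      · split_ifs <;> simp
    simp only [hj, Finset.sum_add_distrib, Finset.sum_ite_eq, Finset.mem_univ, if_true, h,
      if_false]
    norm_num

/-- The spin indicator of `u` under `τ`, averaged out when `u` is isolated. -/
noncomputable def spinProfile {n q : ℕ} (E : Finset (Fin n × Fin n)) (τ : Conf n q)
    (j : Fin q) (u : Fin n) : ℝ :=
  if IsIsolatedIn E u then (q : ℝ)⁻¹ else if τ u = j then 1 else 0

lemma sum_colorWeight_spinProfile_le {n q : ℕ} (hq : 2 ≤ q) (E : Finset (Fin n × Fin n))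
    (u v : Fin n) :
    ∑ τ : Conf n q, colorWeight q E τ * ∑ j, |spinProfile E τ j u - spinProfile E τ j v| ≤
      2 * (1 - (q : ℝ)⁻¹) * (if IsIsolatedIn E u ∧ IsIsolatedIn E v then 0 else 1) := by
  have hone : ∀ x : ℝ, ∑ τ : Conf n q, colorWeight q E τ * x = x := fun x => by
    rw [← Finset.sum_mul, sum_colorWeight hq, one_mul]
  by_cases hu : IsIsolatedIn E u <;> by_cases hv : IsIsolatedIn E v
  · simp [spinProfile, hu, hv]
  · have h : ∀ τ : Conf n q, ∑ j, |spinProfile E τ j u - spinProfile E τ j v| =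
        2 * (1 - (q : ℝ)⁻¹) := fun τ => by
      rw [← sum_abs_centInd hq (τ v)]
      refine Finset.sum_congr rfl fun j _ => ?_
      rw [abs_sub_comm]
      simp [spinProfile, hu, hv, centInd]
    simp only [h, hone]
    simp [hv]
  · have h : ∀ τ : Conf n q, ∑ j, |spinProfile E τ j u - spinProfile E τ j v| =
        2 * (1 - (q : ℝ)⁻¹) := fun τ => by
      rw [← sum_abs_centInd hq (τ u)]
      refine Finset.sum_congr rfl fun j _ => ?_
      simp [spinProfile, hu, hv, centInd]
    simp only [h, hone]
    simp [hu]
  · have h : ∀ τ : Conf n q, ∑ j, |spinProfile E τ j u - spinProfile E τ j v| =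
        2 * (if τ u = τ v then 0 else 1) := fun τ => by
      rw [← sum_abs_indicator_sub]
      simp [spinProfile, hu, hv]
    simp only [h, mul_left_comm _ (2 : ℝ), ← Finset.mul_sum]
    have := sum_colorWeight_ne_le hq E u v
    simp only [hu, hv, false_and, if_false, mul_one]
    linarith

lemma sum_isolated_le {n : ℕ} (E : Finset (Fin n × Fin n)) (g : Fin n → ℝ) :
    ∑ u, ∑ v, (if IsIsolatedIn E u then g u else 0) * (if IsIsolatedIn E v then g v else 0) *
      (if (graphOf E).Reachable u v then 1 else 0) ≤ ∑ u, g u ^ 2 := by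
  refine Finset.sum_le_sum fun u _ => ?_
  by_cases hu : IsIsolatedIn E u
  · rw [Finset.sum_eq_single u]
    · simp [hu, pow_two]
    · intro v _ hvu
      rw [if_neg fun h => hvu (hu.eq_of_reachable h), mul_zero]
    · simp
  · simp [hu, sq_nonneg]

/-- Bound for the expected imbalance after recoloring, given the percolation outcome `E`. -/
lemma sum_colorWeight_abs_spinSum_le {n q : ℕ} (hq : 2 ≤ q) (f : Fin n → ℝ) (σ : Conf n q)
    (E : Finset (Fin n × Fin n)) {w : Fin n → Fin n → ℝ} (hw : ∀ u v, 0 ≤ w u v)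
    (hwy : ∀ y : Fin n → ℝ, ∑ u, classMean f σ u * y u = ∑ u, ∑ v, w u v * (y u - y v))
    {ε : ℝ} (hε : 0 < ε) :
    ∑ τ : Conf n q, colorWeight q E τ * ∑ j, |spinSum f τ j| ≤
      (∑ u, ∑ v, w u v * (2 * (1 - (q : ℝ)⁻¹) *
        (if IsIsolatedIn E u ∧ IsIsolatedIn E v then 0 else 1))) +
      (∑ u, classMean f σ u ^ 2 + (1 - (q : ℝ)⁻¹) * ∑ u, ∑ v,
        (f u - classMean f σ u) * (f v - classMean f σ v) *
          (if (graphOf E).Reachable u v then 1 else 0)) / (2 * ε) + q * ε := by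
  have hq' : (q : ℝ) ≠ 0 := by positivity
  have hq0 : 0 ≤ (q : ℝ)⁻¹ := by positivity
  have hq1 : (q : ℝ)⁻¹ ≤ 1 := inv_le_one_of_one_le₀ (by exact_mod_cast (by omega : 1 ≤ q))
  set g := classMean f σ with hg
  set φ : Fin n → ℝ := fun u => if IsIsolatedIn E u then g u else 0 with hφ
  set h : Fin n → ℝ := fun u => f u - g u with hh
  have hsum0 : ∑ u, h u = 0 := by
    simp only [hh, Finset.sum_sub_distrib, hg, sum_classMean, sub_self]
  have hdecomp : ∀ (τ : Conf n q) j, spinSum f τ j =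
      ∑ u, g u * spinProfile E τ j u + ∑ u, φ u * centInd j (τ u) +
        ∑ u, h u * centInd j (τ u) := by
    intro τ j
    have h1 : spinSum f τ j = ∑ u, (g u * spinProfile E τ j u + φ u * centInd j (τ u) +
        h u * centInd j (τ u)) + (q : ℝ)⁻¹ * ∑ u, h u := by
      rw [Finset.mul_sum, ← Finset.sum_add_distrib]
      refine Finset.sum_congr rfl fun u _ => ?_
      simp only [hh, hφ, spinProfile, centInd]
      split_ifs <;> ring
    rw [h1, hsum0, mul_zero, add_zero, Finset.sum_add_distrib, Finset.sum_add_distrib]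
  have habs : ∀ x : ℝ, |x| ≤ x ^ 2 / (2 * ε) + ε / 2 := by
    intro x
    have : x ^ 2 / (2 * ε) + ε / 2 - |x| = (|x| - ε) ^ 2 / (2 * ε) := by
      rw [← sq_abs x]
      field_simp
      ring
    have h2 : 0 ≤ (|x| - ε) ^ 2 / (2 * ε) := by positivity
    linarith
  have hpt : ∀ τ : Conf n q, ∑ j, |spinSum f τ j| ≤
      (∑ u, ∑ v, w u v * ∑ j, |spinProfile E τ j u - spinProfile E τ j v|) +
      (∑ j, (∑ u, φ u * centInd j (τ u)) ^ 2 + ∑ j, (∑ u, h u * centInd j (τ u)) ^ 2) / (2 * ε)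
        + q * ε := by
    intro τ
    have h1 : ∀ j, |spinSum f τ j| ≤
        (∑ u, ∑ v, w u v * |spinProfile E τ j u - spinProfile E τ j v|) +
        ((∑ u, φ u * centInd j (τ u)) ^ 2 + (∑ u, h u * centInd j (τ u)) ^ 2) / (2 * ε) + ε := by
      intro j
      rw [hdecomp, hwy]
      have ha := habs (∑ u, φ u * centInd j (τ u))
      have hb := habs (∑ u, h u * centInd j (τ u))
      have hc : |∑ u, ∑ v, w u v * (spinProfile E τ j u - spinProfile E τ j v)| ≤
          ∑ u, ∑ v, w u v * |spinProfile E τ j u - spinProfile E τ j v| := by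
        refine (Finset.abs_sum_le_sum_abs _ _).trans (Finset.sum_le_sum fun u _ => ?_)
        refine (Finset.abs_sum_le_sum_abs _ _).trans (Finset.sum_le_sum fun v _ => ?_)
        rw [abs_mul, abs_of_nonneg (hw u v)]
      refine (abs_add_three _ _ _).trans ?_
      rw [add_div]
      linarith
    refine (Finset.sum_le_sum fun j _ => h1 j).trans (le_of_eq ?_)
    simp only [Finset.sum_add_distrib, ← Finset.sum_div, Finset.sum_const, Finset.card_univ,
      Fintype.card_fin, nsmul_eq_mul, Finset.mul_sum]
    congr 2
    rw [Finset.sum_comm]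
    exact Finset.sum_congr rfl fun u _ => Finset.sum_comm
  refine (Finset.sum_le_sum fun τ _ =>
    mul_le_mul_of_nonneg_left (hpt τ) (colorWeight_nonneg q E τ)).trans ?_
  simp only [mul_add, Finset.sum_add_distrib, ← Finset.sum_mul, sum_colorWeight hq, one_mul,
    ← mul_div_assoc, ← Finset.sum_div, sum_colorWeight_sq hq]
  refine add_le_add (add_le_add ?_ ?_) le_rfl
  · simp only [Finset.mul_sum (s := (Finset.univ : Finset (Fin n)))]
    rw [Finset.sum_comm]
    refine Finset.sum_le_sum fun u _ => ?_
    rw [Finset.sum_comm]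
    refine Finset.sum_le_sum fun v _ => ?_
    simp only [mul_left_comm _ (w u v), ← Finset.mul_sum (a := w u v)]
    exact mul_le_mul_of_nonneg_left (sum_colorWeight_spinProfile_le hq E u v) (hw u v)
  · refine div_le_div_of_nonneg_right ?_ (by positivity)
    refine add_le_add ?_ le_rfl
    have hs : 0 ≤ ∑ u, g u ^ 2 := Finset.sum_nonneg fun u _ => sq_nonneg _
    exact (mul_le_mul_of_nonneg_left (sum_isolated_le E g) (sub_nonneg.2 hq1)).trans
      (mul_le_of_le_one_left hs (by linarith))

/-- One Swendsen–Wang step contracts the expected imbalance of a centered function. -/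
lemma sum_swStep_abs_spinSum_le {n q : ℕ} (hq : 2 ≤ q) {β : ℝ} (hβ : 0 ≤ β) (hn : 0 < n)
    {K : ℝ} (hK : 0 < K) {f : Fin n → ℝ} (hf0 : ∑ u, f u = 0) (hf : ∀ u, |f u| ≤ K / n)
    (σ : Conf n q) :
    ∑ τ : Conf n q, swStep n q β σ τ * ∑ j, |spinSum f τ j| ≤
      (1 - (q : ℝ)⁻¹) * (1 - Real.exp (-(2 * β))) * ∑ j, |spinSum f σ j| +
        (q + 3) * K / Real.sqrt n := by
  have hq' : (q : ℝ) ≠ 0 := by positivity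
  have hq0 : 0 ≤ (q : ℝ)⁻¹ := by positivity
  have hq1 : (q : ℝ)⁻¹ ≤ 1 := inv_le_one_of_one_le₀ (by exact_mod_cast (by omega : 1 ≤ q))
  have hn' : (0 : ℝ) < n := by exact_mod_cast hn
  have hsn : 0 < Real.sqrt n := Real.sqrt_pos.2 hn'
  have hsq : Real.sqrt n * Real.sqrt n = n := Real.mul_self_sqrt hn'.le
  set g := classMean f σ with hg
  set ε := K / Real.sqrt n with hε
  have hεpos : 0 < ε := by positivity
  obtain ⟨w, hw0, hw1, hwy⟩ := exists_transport g ((sum_classMean f σ).trans hf0)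
  rw [hg, sum_abs_classMean] at hw1
  have hgle : ∑ u, g u ^ 2 ≤ K ^ 2 / n := by
    have : ∀ u ∈ (Finset.univ : Finset (Fin n)), g u ^ 2 ≤ (K / n) ^ 2 := fun u _ => by
      rw [← sq_abs]
      exact pow_le_pow_left₀ (abs_nonneg _) (abs_classMean_le hf σ u) 2
    refine (Finset.sum_le_card_nsmul _ _ _ this).trans (le_of_eq ?_)
    simp only [Finset.card_univ, Fintype.card_fin, nsmul_eq_mul]
    field_simp
  have hhle : ∑ u, (f u - g u) ^ 2 ≤ 4 * K ^ 2 / n := by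
    have : ∀ u ∈ (Finset.univ : Finset (Fin n)), (f u - g u) ^ 2 ≤ (2 * (K / n)) ^ 2 :=
      fun u _ => by
        rw [← sq_abs]
        refine pow_le_pow_left₀ (abs_nonneg _) ((abs_sub _ _).trans ?_) 2
        linarith [hf u, abs_classMean_le hf σ u]
    refine (Finset.sum_le_card_nsmul _ _ _ this).trans (le_of_eq ?_)
    simp only [Finset.card_univ, Fintype.card_fin, nsmul_eq_mul]
    field_simp
    ring
  have hconn : ∑ u, ∑ v, (f u - g u) * (f v - g v) * connProb n β (monoPairs σ) u v ≤
      4 * K ^ 2 / n := by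
    refine (sum_connProb_le hβ σ _ fun j => ?_).trans hhle
    have := spinSum_classMean f σ j
    simp only [spinSum] at this
    rw [← sub_eq_zero, ← Finset.sum_sub_distrib] at this
    refine neg_eq_zero.1 ?_
    rw [← Finset.sum_neg_distrib]
    exact (Finset.sum_congr rfl fun u _ => by split_ifs <;> ring).trans this
  have hstep : ∑ τ : Conf n q, swStep n q β σ τ * ∑ j, |spinSum f τ j| =
      ∑ E ∈ (monoPairs σ).powerset, edgeWeight n β (monoPairs σ) E *
        ∑ τ : Conf n q, colorWeight q E τ * ∑ j, |spinSum f τ j| := by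
    simp only [swStep_eq, Finset.sum_mul, Finset.mul_sum (s := (Finset.univ : Finset (Conf n q)))]
    rw [Finset.sum_comm]
    exact Finset.sum_congr rfl fun E _ => Finset.sum_congr rfl fun τ _ => mul_assoc _ _ _
  rw [hstep]
  refine (Finset.sum_le_sum fun E _ => mul_le_mul_of_nonneg_left
    (sum_colorWeight_abs_spinSum_le hq f σ E hw0 hwy hεpos) (edgeWeight_nonneg hβ _ E)).trans ?_
  rw [← hg]
  simp only [mul_add, Finset.sum_add_distrib, ← Finset.sum_mul, sum_edgeWeight, one_mul,
    ← mul_div_assoc, ← Finset.sum_div]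
  have hA : ∑ E ∈ (monoPairs σ).powerset, edgeWeight n β (monoPairs σ) E *
      ∑ u, ∑ v, w u v * (2 * (1 - (q : ℝ)⁻¹) *
        (if IsIsolatedIn E u ∧ IsIsolatedIn E v then 0 else 1)) ≤
      (1 - (q : ℝ)⁻¹) * (1 - Real.exp (-(2 * β))) * ∑ j, |spinSum f σ j| := by
    rw [← hw1]
    simp only [Finset.mul_sum (s := (Finset.univ : Finset (Fin n)))]
    rw [Finset.sum_comm]
    refine Finset.sum_le_sum fun u _ => ?_
    rw [Finset.sum_comm]
    refine Finset.sum_le_sum fun v _ => ?_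
    have h1 := exp_le_sum_edgeWeight_isolated hβ σ u v
    have h2 : 0 ≤ w u v * (2 * (1 - (q : ℝ)⁻¹)) :=
      mul_nonneg (hw0 u v) (by linarith)
    calc _ = w u v * (2 * (1 - (q : ℝ)⁻¹)) *
          ∑ E ∈ (monoPairs σ).powerset, edgeWeight n β (monoPairs σ) E *
            (if IsIsolatedIn E u ∧ IsIsolatedIn E v then 0 else 1) := by
          rw [Finset.mul_sum]
          exact Finset.sum_congr rfl fun E _ => by ring
      _ ≤ w u v * (2 * (1 - (q : ℝ)⁻¹)) * (1 - Real.exp (-(2 * β))) :=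
          mul_le_mul_of_nonneg_left h1 h2
      _ = _ := by ring
  have hB : ∑ E ∈ (monoPairs σ).powerset, edgeWeight n β (monoPairs σ) E *
      ((1 - (q : ℝ)⁻¹) * ∑ u, ∑ v, (f u - g u) * (f v - g v) *
        (if (graphOf E).Reachable u v then 1 else 0)) ≤ 4 * K ^ 2 / n := by
    have h1 : ∑ E ∈ (monoPairs σ).powerset, edgeWeight n β (monoPairs σ) E *
        ((1 - (q : ℝ)⁻¹) * ∑ u, ∑ v, (f u - g u) * (f v - g v) *
          (if (graphOf E).Reachable u v then 1 else 0)) =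
        (1 - (q : ℝ)⁻¹) *
          ∑ u, ∑ v, (f u - g u) * (f v - g v) * connProb n β (monoPairs σ) u v := by
      simp only [connProb, Finset.mul_sum]
      rw [Finset.sum_comm]
      refine Finset.sum_congr rfl fun u _ => ?_
      rw [Finset.sum_comm]
      exact Finset.sum_congr rfl fun v _ => Finset.sum_congr rfl fun E _ => by ring
    rw [h1]
    refine (mul_le_mul_of_nonneg_left hconn (sub_nonneg.2 hq1)).trans ?_
    exact mul_le_of_le_one_left (by positivity) (by linarith)
  have hC : (K ^ 2 / n + 4 * K ^ 2 / n) / (2 * ε) + q * ε ≤ (q + 3) * K / Real.sqrt n := by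
    have : (K ^ 2 / n + 4 * K ^ 2 / n) / (2 * ε) = 5 / 2 * (K / Real.sqrt n) := by
      have haux : ∀ s : ℝ, 0 < s →
          (K ^ 2 / (s * s) + 4 * K ^ 2 / (s * s)) / (2 * (K / s)) = 5 / 2 * (K / s) := by
        intro s hs
        field_simp
        ring
      rw [hε]
      simpa only [hsq] using haux (Real.sqrt n) hsn
    rw [this, mul_div_assoc]
    nlinarith
  have hD := div_le_div_of_nonneg_right (add_le_add hgle hB) (by positivity : 0 ≤ 2 * ε)
  linarith

lemma sum_swStep {n q : ℕ} (hq : 2 ≤ q) (β : ℝ) (σ : Conf n q) :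
    ∑ τ : Conf n q, swStep n q β σ τ = 1 := by
  simp only [swStep_eq]
  rw [Finset.sum_comm]
  simp only [← Finset.mul_sum, sum_colorWeight hq, mul_one, sum_edgeWeight]

lemma swProb_nonneg {n q : ℕ} {β : ℝ} (hβ : 0 ≤ β) (t : ℕ) (σ τ : Conf n q) :
    0 ≤ swProb n q β t σ τ := by
  induction t generalizing σ with
  | zero => unfold swProb; split_ifs <;> simp
  | succ t ih =>
    exact Finset.sum_nonneg fun η _ => mul_nonneg (swStep_nonneg hβ _ _) (ih η)

lemma sum_swProb_succ_mul {n q : ℕ} (β : ℝ) (t : ℕ) (σ : Conf n q) (g : Conf n q → ℝ) :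
    ∑ τ : Conf n q, swProb n q β (t + 1) σ τ * g τ =
      ∑ η : Conf n q, swStep n q β σ η * ∑ τ : Conf n q, swProb n q β t η τ * g τ := by
  simp only [swProb, Finset.sum_mul, Finset.mul_sum]
  rw [Finset.sum_comm]
  exact Finset.sum_congr rfl fun η _ => Finset.sum_congr rfl fun τ _ => mul_assoc _ _ _

lemma sum_swProb {n q : ℕ} (hq : 2 ≤ q) (β : ℝ) (t : ℕ) (σ : Conf n q) :
    ∑ τ : Conf n q, swProb n q β t σ τ = 1 := by
  induction t generalizing σ with
  | zero => simp [swProb]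
  | succ t ih =>
    have h := sum_swProb_succ_mul β t σ (fun _ => 1)
    simpa only [mul_one, ih, sum_swStep hq] using h

/-- A drift bound for one step of the dynamics iterates to any number of steps. -/
lemma sum_swProb_mul_le {n q : ℕ} (hq : 2 ≤ q) {β : ℝ} (hβ : 0 ≤ β) {g : Conf n q → ℝ}
    {a c : ℝ} (ha0 : 0 ≤ a) (ha1 : a < 1)
    (hg : ∀ σ, ∑ τ : Conf n q, swStep n q β σ τ * g τ ≤ a * g σ + c) (t : ℕ) (σ : Conf n q) :
    ∑ τ : Conf n q, swProb n q β t σ τ * g τ ≤ a ^ t * g σ + c * (1 - a ^ t) / (1 - a) := by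
  have h1a : (1 - a) ≠ 0 := by linarith
  induction t generalizing σ with
  | zero => simp [swProb]
  | succ t ih =>
    rw [sum_swProb_succ_mul]
    refine (Finset.sum_le_sum fun η _ =>
      mul_le_mul_of_nonneg_left (ih η) (swStep_nonneg hβ σ η)).trans ?_
    simp only [mul_add, mul_left_comm _ (a ^ t), Finset.sum_add_distrib, ← Finset.mul_sum,
      ← Finset.sum_mul, sum_swStep hq, one_mul]
    refine (add_le_add (mul_le_mul_of_nonneg_left (hg σ) (pow_nonneg ha0 t)) le_rfl).trans
      (le_of_eq ?_)
    field_simp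
    ring

/-- The normalized indicator of `S`, centered over the whole vertex set. -/
noncomputable def blockDev {n : ℕ} (S : Finset (Fin n)) (u : Fin n) : ℝ :=
  (if u ∈ S then (S.card : ℝ)⁻¹ else 0) - (n : ℝ)⁻¹

lemma sum_blockDev {n : ℕ} (hn : 0 < n) {S : Finset (Fin n)} (hS : 0 < S.card) :
    ∑ u, blockDev S u = 0 := by
  have h1 : (n : ℝ) ≠ 0 := by positivity
  have h2 : (S.card : ℝ) ≠ 0 := by positivity
  simp [blockDev, h1, h2]

lemma abs_blockDev_le {n : ℕ} {S : Finset (Fin n)} {B : ℝ} (hS : (S.card : ℝ)⁻¹ ≤ B)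
    (hn : (n : ℝ)⁻¹ ≤ B) (u : Fin n) : |blockDev S u| ≤ B := by
  have h1 : 0 ≤ (n : ℝ)⁻¹ := by positivity
  have h2 : 0 ≤ (S.card : ℝ)⁻¹ := by positivity
  unfold blockDev
  rw [abs_le]
  split_ifs <;> constructor <;> linarith

lemma domIdx_lt {n q : ℕ} (hq : 2 ≤ q) (X : Conf n q) : domIdx X < q := by
  have : Nonempty (Fin q) := ⟨⟨0, by omega⟩⟩
  obtain ⟨j, hj⟩ := Finite.exists_max (fun j : Fin q => cntN X j)
  have hne : {j : ℕ | ∃ hj : j < q, ∀ j' : Fin q, cntN X j' ≤ cntN X ⟨j, hj⟩}.Nonempty :=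
    ⟨j, j.2, hj⟩
  exact (Nat.sInf_mem hne).1

lemma abs_alpha1_sub_alpha1In_le {n q : ℕ} (hq : 2 ≤ q) (X : Conf n q) (S : Finset (Fin n)) :
    |alpha1 X - alpha1In X S| ≤ ∑ j, |spinSum (blockDev S) X j| := by
  set d : Fin q := ⟨domIdx X, domIdx_lt hq X⟩ with hd
  have hiff : ∀ v, (X v : ℕ) = domIdx X ↔ X v = d := fun v => by rw [hd, Fin.ext_iff]
  have h : alpha1 X - alpha1In X S = -spinSum (blockDev S) X d := by
    have h1 : spinSum (blockDev S) X d =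
        ∑ u ∈ S, (if X u = d then (S.card : ℝ)⁻¹ else 0) -
          ∑ u, (if X u = d then (n : ℝ)⁻¹ else 0) := by
      have h2 : ∑ u ∈ S, (if X u = d then (S.card : ℝ)⁻¹ else 0) =
          ∑ u, (if u ∈ S then (if X u = d then (S.card : ℝ)⁻¹ else 0) else 0) := by
        rw [Finset.sum_ite_mem, Finset.univ_inter]
      rw [h2, ← Finset.sum_sub_distrib]
      refine Finset.sum_congr rfl fun u _ => ?_
      unfold blockDev
      split_ifs <;> simp
    rw [h1]
    simp only [alpha1, alpha1In, hiff, ← Finset.sum_filter, Finset.sum_const, nsmul_eq_mul,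
      div_eq_mul_inv]
    ring
  rw [h, abs_neg]
  exact Finset.single_le_sum (f := fun j => |spinSum (blockDev S) X j|)
    (fun j _ => abs_nonneg _) (Finset.mem_univ d)

lemma sum_abs_spinSum_le {n q : ℕ} {f : Fin n → ℝ} {B : ℝ} (hf : ∀ u, |f u| ≤ B)
    (X : Conf n q) : ∑ j, |spinSum f X j| ≤ n * B := by
  rw [← sum_abs_classMean]
  have := Finset.sum_le_card_nsmul (Finset.univ : Finset (Fin n)) (fun u => |classMean f X u|) B
    fun u _ => abs_classMean_le hf X u
  simpa using this

/-- Lemma 3.3: for a `λ`-partition `{V₁,…,V_q}` and any initial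
configuration, after `T ≥ log n / (2 log(q/(q-1))) + log(2/C)/log(q/(q-1))` steps,
with probability at least `δ`, `max_k |α₁(X_T) - α_{1,k}(X_T)| ≤ C/√n`. -/
theorem sw_partition_convergence (q : ℕ) (hq : 2 ≤ q) (β : ℝ) (hβ : (q : ℝ) < β)
    (lam : ℝ) (hlam : lam ∈ Set.Ioo (0 : ℝ) 1) (δ : ℝ) (hδ : δ ∈ Set.Ioo (0 : ℝ) 1) :
    ∃ C : ℝ, 0 < C ∧ ∃ N : ℕ, ∀ n : ℕ, N ≤ n →
      ∀ P : Fin q → Finset (Fin n), IsLamPartition lam P →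
      ∀ X₀ : Conf n q, ∀ T : ℕ,
        Real.log n / (2 * Real.log ((q : ℝ) / ((q : ℝ) - 1))) +
            Real.log (2 / C) / Real.log ((q : ℝ) / ((q : ℝ) - 1)) ≤ (T : ℝ) →
        δ ≤ ∑ τ : Conf n q,
          (if ∀ k : Fin q, |alpha1 τ - alpha1In τ (P k)| ≤ C / Real.sqrt n
            then swProb n q β T X₀ τ else 0) := by
  have hq2 : (2 : ℝ) ≤ q := by exact_mod_cast hq
  have hβ0 : 0 ≤ β := by linarith
  obtain ⟨hlam0, hlam1⟩ := hlam
  obtain ⟨hδ0, hδ1⟩ := hδ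
  set b : ℝ := 1 - (q : ℝ)⁻¹ with hb
  set r : ℝ := 1 - Real.exp (-(2 * β)) with hr
  set K : ℝ := lam⁻¹ with hK
  have hqi : (q : ℝ)⁻¹ ≤ 2⁻¹ := inv_anti₀ (by norm_num) hq2
  have hqi0 : 0 < (q : ℝ)⁻¹ := by positivity
  have hb0 : 0 < b := by rw [hb]; linarith
  have hb1 : b < 1 := by rw [hb]; linarith
  have hr0 : 0 ≤ r := by
    have := Real.exp_le_one_iff.2 (by linarith : -(2 * β) ≤ 0)
    rw [hr]; linarith
  have hr1 : r < 1 := by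
    have := Real.exp_pos (-(2 * β))
    rw [hr]; linarith
  have hK0 : 0 < K := by positivity
  have hK1 : 1 ≤ K := (one_le_inv₀ hlam0).2 hlam1.le
  set a : ℝ := b * r with ha
  have ha0 : 0 ≤ a := by positivity
  have ha1 : a < 1 := by nlinarith
  have h1a : 0 < 1 - a := by linarith
  have hqb : (q : ℝ) / ((q : ℝ) - 1) = b⁻¹ := by
    have : (q : ℝ) - 1 ≠ 0 := by linarith
    rw [hb]
    field_simp
  rw [hqb]
  set L : ℝ := Real.log b⁻¹ with hL
  have hL0 : 0 < L := Real.log_pos ((one_lt_inv₀ hb0).2 hb1)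
  set C : ℝ := 2 * q * ((q + 3) * K) / ((1 - a) * (1 - δ)) with hC
  have h1δ : 0 < 1 - δ := by linarith
  have hC0 : 0 < C := by positivity
  obtain ⟨T₀, hT₀⟩ := exists_pow_lt_of_lt_one (show 0 < (1 - δ) / (q * K) by positivity) hr1
  have hlim : Filter.Tendsto (fun n : ℕ => Real.log n / (2 * L) + Real.log (2 / C) / L)
      Filter.atTop Filter.atTop :=
    Filter.tendsto_atTop_add_const_right _ _
      ((Real.tendsto_log_atTop.comp tendsto_natCast_atTop_atTop).atTop_div_const (by positivity))
  obtain ⟨N, hN⟩ := Filter.eventually_atTop.1 (hlim.eventually_ge_atTop (T₀ : ℝ))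
  refine ⟨C, hC0, max N 1, fun n hn P hP X₀ T hT => ?_⟩
  have hn0 : 0 < n := lt_of_lt_of_le one_pos ((le_max_right N 1).trans hn)
  have hn' : (0 : ℝ) < n := by exact_mod_cast hn0
  have hsn : 0 < Real.sqrt n := Real.sqrt_pos.2 hn'
  have hTT₀ : T₀ ≤ T := by
    exact_mod_cast (hN n ((le_max_left N 1).trans hn)).trans hT
  have hrT : r ^ T ≤ (1 - δ) / (q * K) :=
    (pow_le_pow_of_le_one hr0 hr1.le hTT₀).trans hT₀.le
  have hbT : b ^ T ≤ C / (2 * Real.sqrt n) := by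
    have h1 : Real.log (2 * Real.sqrt n / C) ≤ T * L := by
      have h2 : Real.log (2 * Real.sqrt n / C) = Real.log n / 2 + Real.log (2 / C) := by
        rw [mul_div_right_comm, Real.log_mul (by positivity) hsn.ne', Real.log_sqrt hn'.le]
        ring
      have h3 := mul_le_mul_of_nonneg_right hT hL0.le
      rw [h2]
      refine le_trans (le_of_eq ?_) h3
      field_simp
    rw [hL, ← Real.log_pow, Real.log_le_log_iff (by positivity) (by positivity), inv_pow] at h1
    rw [← inv_inv (b ^ T), ← inv_div]
    exact inv_anti₀ (by positivity) h1
  have hcard : ∀ k, lam * n ≤ ((P k).card : ℝ) := hP.2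
  have hcard0 : ∀ k, 0 < (P k).card := fun k => by
    have := (mul_pos hlam0 hn').trans_le (hcard k)
    exact_mod_cast this
  have hdev : ∀ k u, |blockDev (P k) u| ≤ K / n := by
    intro k
    refine abs_blockDev_le ?_ ?_
    · refine (inv_anti₀ (mul_pos hlam0 hn') (hcard k)).trans (le_of_eq ?_)
      rw [mul_inv, div_eq_mul_inv]
    · rw [div_eq_mul_inv]
      exact le_mul_of_one_le_left (by positivity) hK1
  set G : Fin q → Conf n q → ℝ := fun k τ => ∑ j, |spinSum (blockDev (P k)) τ j| with hG
  have hG0 : ∀ k τ, 0 ≤ G k τ := fun k τ => Finset.sum_nonneg fun j _ => abs_nonneg _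
  have hexp : ∀ k, ∑ τ : Conf n q, swProb n q β T X₀ τ * G k τ ≤
      (1 - δ) * C / (q * Real.sqrt n) := by
    intro k
    have h1 := sum_swProb_mul_le hq hβ0 ha0 ha1 (fun σ => sum_swStep_abs_spinSum_le hq hβ0 hn0 hK0
      (sum_blockDev hn0 (hcard0 k)) (hdev k) σ) T X₀
    have h2 : G k X₀ ≤ K :=
      (sum_abs_spinSum_le (hdev k) X₀).trans (le_of_eq (by field_simp))
    have h3 : a ^ T * G k X₀ ≤ (1 - δ) * C / (2 * q * Real.sqrt n) := by
      calc a ^ T * G k X₀ ≤ (b ^ T * r ^ T) * K := by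
            rw [ha, mul_pow]
            exact mul_le_mul_of_nonneg_left h2 (by positivity)
        _ ≤ (C / (2 * Real.sqrt n) * ((1 - δ) / (q * K))) * K := by gcongr
        _ = _ := by field_simp
    have h4 : (q + 3) * K / Real.sqrt n * (1 - a ^ T) / (1 - a) ≤
        (1 - δ) * C / (2 * q * Real.sqrt n) := by
      calc (q + 3) * K / Real.sqrt n * (1 - a ^ T) / (1 - a)
          ≤ (q + 3) * K / Real.sqrt n * 1 / (1 - a) := by
            gcongr
            have := pow_nonneg ha0 T
            linarith
        _ = _ := by
            rw [hC]
            field_simp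
    refine h1.trans ((add_le_add h3 h4).trans (le_of_eq ?_))
    field_simp
    ring
  have hpt : ∀ τ : Conf n q, swProb n q β T X₀ τ -
      ∑ k, swProb n q β T X₀ τ * G k τ * (Real.sqrt n / C) ≤
      (if ∀ k : Fin q, |alpha1 τ - alpha1In τ (P k)| ≤ C / Real.sqrt n
            then swProb n q β T X₀ τ else 0) := by
    intro τ
    have hp := swProb_nonneg hβ0 T X₀ τ
    have hk0 : ∀ k, 0 ≤ swProb n q β T X₀ τ * G k τ * (Real.sqrt n / C) := fun k =>
      mul_nonneg (mul_nonneg hp (hG0 k τ)) (by positivity)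
    split_ifs with hgood
    · linarith [Finset.sum_nonneg fun k (_ : k ∈ Finset.univ) => hk0 k]
    · push Not at hgood
      obtain ⟨k, hk⟩ := hgood
      have h1 := hk.le.trans (abs_alpha1_sub_alpha1In_le hq τ (P k))
      have h2 : 1 ≤ G k τ * (Real.sqrt n / C) := by
        rw [div_le_iff₀ hsn] at h1
        rw [← mul_div_assoc, one_le_div hC0]
        exact h1
      have h3 := Finset.single_le_sum (fun k _ => hk0 k) (Finset.mem_univ k)
      have h4 := mul_le_mul_of_nonneg_left h2 hp
      rw [← mul_assoc] at h4
      linarith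
  refine le_trans ?_ (Finset.sum_le_sum fun τ _ => hpt τ)
  rw [Finset.sum_sub_distrib, sum_swProb hq, Finset.sum_comm]
  simp only [← Finset.sum_mul]
  have hsum : (∑ k, ∑ τ : Conf n q, swProb n q β T X₀ τ * G k τ) ≤
      q * ((1 - δ) * C / (q * Real.sqrt n)) := by
    have := Finset.sum_le_card_nsmul (Finset.univ : Finset (Fin q)) _ _ fun k _ => hexp k
    simpa using this
  have hfin := mul_le_mul_of_nonneg_right hsum (by positivity : 0 ≤ Real.sqrt n / C)
  have heq : q * ((1 - δ) * C / (q * Real.sqrt n)) * (Real.sqrt n / C) = 1 - δ := by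
    field_simp
  linarith
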